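/- arXiv:1906.07810 — 4 statements merged into one kernel-verified Lean document; each statement's English description precedes it below -/
import Mathlib

section
/- Mellin inversion: Let f : (0,∞) → ℂ and let a < c < b be real numbers. Suppose that for every s ∈ ℂ with a < Re s < b the function ω ↦ ω^(s−1) f(ω) is absolutely integrable on (0,∞), defining F(s) = ∫₀^∞ ω^(s−1) f(ω) dω. Suppose further that t ↦ F(c + it) is absolutely integrable on ℝ and that f is continuous at a point ω₀ > 0. Then f(ω₀) = (1/(2π)) ∫_ℝ ω₀^(−(c+it)) F(c + it) dt. -/
open MeasureTheory Complex Real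

/-- Mellin inversion. -/
theorem mellin_inversion_statement
    (f : ℝ → ℂ) (a b c : ℝ) (hac : a < c) (hcb : c < b)
    (F : ℂ → ℂ)
    (hint : ∀ s : ℂ, a < s.re → s.re < b →
      IntegrableOn (fun ω : ℝ => (ω : ℂ) ^ (s - 1) * f ω) (Set.Ioi 0))
    (hF : ∀ s : ℂ, a < s.re → s.re < b →
      F s = ∫ ω in Set.Ioi (0 : ℝ), (ω : ℂ) ^ (s - 1) * f ω)
    (hFint : Integrable (fun t : ℝ => F (c + t * Complex.I)))
    (ω₀ : ℝ) (hω₀ : 0 < ω₀) (hcont : ContinuousAt f ω₀) :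
    f ω₀ = (1 / (2 * π)) *
      ∫ t : ℝ, (ω₀ : ℂ) ^ (-(c + t * Complex.I)) * F (c + t * Complex.I) := by
  have hFm : ∀ t : ℝ, F (c + t * Complex.I) = mellin f (c + t * Complex.I) := by
    intro t
    rw [hF _ (by simpa using hac) (by simpa using hcb)]
    simp only [mellin, smul_eq_mul]
  have hconv : MellinConvergent f (c : ℂ) := by
    have h := hint (c : ℂ) (by simpa using hac) (by simpa using hcb)
    simpa only [MellinConvergent, smul_eq_mul] using h
  simp only [hFm] at hFint ⊢
  have key := mellinInv_mellin_eq c f hω₀ hconv hFint hcont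
  refine key.symm.trans ?_
  rw [mellinInv]
  simp only [smul_eq_mul, Complex.real_smul]
  push_cast
  rfl
end

section
/- Direct mapping theorem (power-law case): Let f : (0,∞) → ℂ be measurable, let N be a positive integer, let b > 0, and suppose there exist complex numbers c₀, …, c_{N−1} and a constant C > 0 such that |f(ω) − Σ_{k=0}^{N−1} c_k ω^k| ≤ C·ω^N for all ω ∈ (0,1] and |f(ω)| ≤ C·ω^(−b) for all ω ∈ [1,∞). Let F(s) = ∫₀^∞ ω^(s−1) f(ω) dω, which converges absolutely for 0 < Re s < b. Then there exists a function G holomorphic on the open strip {s : −N < Re s < b} such that F(s) = Σ_{k=0}^{N−1} c_k/(s + k) + G(s) for all s with 0 < Re s < b. In particular F extends meromorphically to {s : −N < Re s < b} with at most simple poles at s = 0, −1, …, −(N−1), the residue at s = −k being c_k. -/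
open MeasureTheory Complex Real

/-- Direct mapping theorem (power-law case): the asymptotic expansion of `f` at `0`
yields a meromorphic continuation of its Mellin transform with simple poles at
`s = 0, -1, …, -(N-1)` and residues `c k`. -/
theorem mellin_direct_mapping
    (f : ℝ → ℂ) (hf : Measurable f) (N : ℕ) (hN : 0 < N) (b : ℝ) (hb : 0 < b)
    (c : ℕ → ℂ) (C : ℝ) (hC : 0 < C)
    (h0 : ∀ ω : ℝ, ω ∈ Set.Ioc (0 : ℝ) 1 →
      ‖f ω - ∑ k ∈ Finset.range N, c k * (ω : ℂ) ^ (k : ℕ)‖ ≤ C * ω ^ (N : ℕ))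
    (hinf : ∀ ω : ℝ, ω ∈ Set.Ici (1 : ℝ) → ‖f ω‖ ≤ C * ω ^ (-b))
    (F : ℂ → ℂ)
    (hF : ∀ s : ℂ, 0 < s.re → s.re < b →
      F s = ∫ ω in Set.Ioi (0 : ℝ), (ω : ℂ) ^ (s - 1) * f ω) :
    (∀ s : ℂ, 0 < s.re → s.re < b →
        IntegrableOn (fun ω : ℝ => (ω : ℂ) ^ (s - 1) * f ω) (Set.Ioi 0)) ∧
      ∃ G : ℂ → ℂ,
        DifferentiableOn ℂ G {s : ℂ | -(N : ℝ) < s.re ∧ s.re < b} ∧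
          ∀ s : ℂ, 0 < s.re → s.re < b →
            F s = (∑ k ∈ Finset.range N, c k / (s + (k : ℂ))) + G s := by
  classical
  set p : ℕ → ℝ → ℂ := fun k => Set.indicator (Set.Ioc 0 1) (fun t : ℝ => (t : ℂ) ^ (k : ℂ)) with hp
  set g : ℝ → ℂ := fun t => f t - ∑ k ∈ Finset.range N, c k * p k t with hg
  have hpm : ∀ k, Measurable (p k) := fun k =>
    Measurable.indicator (by fun_prop) measurableSet_Ioc
  have hgm : Measurable g :=
    hf.sub (Finset.measurable_fun_sum _ fun k _ => (hpm k).const_mul (c k))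
  have hg0 : ∀ t ∈ Set.Ioc (0 : ℝ) 1, ‖g t‖ ≤ C * t ^ N := by
    intro t ht
    have := h0 t ht
    simpa [hg, hp, Set.indicator_of_mem ht] using this
  have hg1 : ∀ t : ℝ, 1 < t → ‖g t‖ ≤ C * t ^ (-b) := by
    intro t ht
    have := hinf t ht.le
    have h' : t ∉ Set.Ioc (0 : ℝ) 1 := fun h => absurd h.2 (not_le.mpr ht)
    simpa [hg, hp, Set.indicator_of_notMem h'] using this
  have hgb : ∀ t ∈ Set.Ioi (0 : ℝ), ‖g t‖ ≤ C := by
    intro t ht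
    have ht0 : (0 : ℝ) < t := ht
    rcases le_or_gt t 1 with h | h
    · refine (hg0 t ⟨ht, h⟩).trans ?_
      exact mul_le_of_le_one_right hC.le (pow_le_one₀ ht0.le h)
    · refine (hg1 t h).trans ?_
      exact mul_le_of_le_one_right hC.le
        (Real.rpow_le_one_of_one_le_of_nonpos h.le (by linarith))
  have hloc : LocallyIntegrableOn g (Set.Ioi 0) := by
    have hc : LocallyIntegrableOn (fun _ : ℝ => C) (Set.Ioi 0) :=
      (locallyIntegrable_const C).locallyIntegrableOn _
    rw [locallyIntegrableOn_iff isOpen_Ioi.isLocallyClosed] at hc ⊢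
    intro K hK hKc
    refine Integrable.mono' (hc K hK hKc) hgm.aestronglyMeasurable ?_
    exact (ae_restrict_iff' hKc.measurableSet).mpr (Filter.Eventually.of_forall
      fun t ht => hgb t (hK ht))
  have htop : g =O[Filter.atTop] (fun t : ℝ => t ^ (-b)) := by
    refine Asymptotics.IsBigO.of_bound C ?_
    filter_upwards [Filter.eventually_gt_atTop (1 : ℝ)] with t ht
    rw [Real.norm_of_nonneg (Real.rpow_nonneg (by linarith) _)]
    exact hg1 t ht
  have hbot : g =O[nhdsWithin 0 (Set.Ioi 0)] (fun t : ℝ => t ^ (-(-(N : ℝ)))) := by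
    refine Asymptotics.IsBigO.of_bound C ?_
    filter_upwards [Ioc_mem_nhdsGT (zero_lt_one' ℝ)] with t ht
    rw [Real.norm_of_nonneg (Real.rpow_nonneg ht.1.le _), neg_neg, Real.rpow_natCast]
    exact hg0 t ht
  have hN' : (0 : ℝ) < N := by exact_mod_cast hN
  have key : ∀ s : ℂ, 0 < s.re → s.re < b →
      HasMellin f s ((∑ k ∈ Finset.range N, c k / (s + (k : ℂ))) + mellin g s) := by
    intro s hs hsb
    have hgc : MellinConvergent g s :=
      mellinConvergent_of_isBigO_rpow hloc htop hsb hbot (by linarith)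
    have hk : ∀ k : ℕ, HasMellin (p k) s (1 / (s + k)) := fun k =>
      hasMellin_cpow_Ioc (k : ℂ) (by simp; positivity)
    have hsum : ∀ M : ℕ, HasMellin (fun t => ∑ k ∈ Finset.range M, c k * p k t) s
        (∑ k ∈ Finset.range M, c k / (s + (k : ℂ))) := by
      intro M
      induction M with
      | zero => simp [HasMellin, MellinConvergent, mellin]
      | succ M ih =>
        have h1 := hasMellin_const_smul (hk M).1 (c M)
        have h2 := hasMellin_add ih.1 h1.1
        simp only [Finset.sum_range_succ]
        refine ⟨h2.1, h2.2.trans ?_⟩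
        rw [ih.2, h1.2, (hk M).2, smul_eq_mul, mul_one_div]
    have h := hasMellin_add (hsum N).1 hgc
    rw [(hsum N).2] at h
    simpa [hg] using h
  refine ⟨fun s hs hsb => (key s hs hsb).1, mellin g, ?_, ?_⟩
  · intro s hs
    exact (mellin_differentiableAt_of_isBigO_rpow hloc htop hs.2 hbot hs.1).differentiableWithinAt
  · intro s hs hsb
    rw [hF s hs hsb]
    exact (key s hs hsb).2
end

section
/- Singular expansion of the Gamma function: The function E(z) = ∫₁^∞ t^(z−1) e^(−t) dt is entire (complex differentiable at every z ∈ ℂ), and for every z ∈ ℂ that is not a nonpositive integer the series Σ_{k=0}^∞ (−1)^k / (k! (z + k)) converges and Γ(z) = Σ_{k=0}^∞ (−1)^k / (k! (z + k)) + E(z). -/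
open MeasureTheory Complex

lemma gse_bot (s : ℂ) : (Set.indicator (Set.Ioi (1:ℝ)) (fun t : ℝ => ((Real.exp (-t) : ℝ) : ℂ)))
    =O[nhdsWithin 0 (Set.Ioi 0)] (fun t : ℝ => t ^ (-(s.re - 1))) := by
  have : (Set.indicator (Set.Ioi (1:ℝ)) (fun t : ℝ => ((Real.exp (-t) : ℝ) : ℂ)))
      =ᶠ[nhdsWithin 0 (Set.Ioi 0)] fun _ => (0 : ℂ) := by
    have h1 : Set.Iio (1:ℝ) ∈ nhdsWithin (0:ℝ) (Set.Ioi 0) :=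
      mem_nhdsWithin_of_mem_nhds (Iio_mem_nhds one_pos)
    filter_upwards [h1] with t ht
    apply Set.indicator_of_notMem
    simp only [Set.mem_Ioi, not_lt]
    exact le_of_lt ht
  exact this.trans_isBigO (Asymptotics.isBigO_zero _ _)

lemma gse_top : (Set.indicator (Set.Ioi (1:ℝ)) (fun t : ℝ => ((Real.exp (-t) : ℝ) : ℂ)))
    =O[Filter.atTop] (fun t : ℝ => Real.exp (-1 * t)) := by
  apply Asymptotics.IsBigO.of_bound 1
  filter_upwards with t
  refine (norm_indicator_le_norm_self _ _).trans ?_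
  rw [Complex.norm_real, neg_one_mul, one_mul]

lemma gse_loc : LocallyIntegrableOn
    (Set.indicator (Set.Ioi (1:ℝ)) (fun t : ℝ => ((Real.exp (-t) : ℝ) : ℂ))) (Set.Ioi 0) := by
  apply LocallyIntegrable.locallyIntegrableOn
  apply LocallyIntegrable.indicator _ measurableSet_Ioi
  apply Continuous.locallyIntegrable
  fun_prop

lemma gse_eq (s : ℂ) : mellin (Set.indicator (Set.Ioi (1:ℝ))
      (fun t : ℝ => ((Real.exp (-t) : ℝ) : ℂ))) s
    = ∫ t in Set.Ioi (1 : ℝ), (t : ℂ) ^ (s - 1) * Real.exp (-t) := by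
  have h : ∀ t : ℝ, (t : ℂ) ^ (s - 1) • (Set.indicator (Set.Ioi (1:ℝ))
      (fun t : ℝ => ((Real.exp (-t) : ℝ) : ℂ))) t = Set.indicator (Set.Ioi (1:ℝ))
      (fun t : ℝ => (t : ℂ) ^ (s - 1) * ((Real.exp (-t) : ℝ) : ℂ)) t := by
    intro t
    by_cases ht : t ∈ Set.Ioi (1:ℝ) <;> simp only [ht, Set.indicator_of_mem,
      Set.indicator_of_notMem, smul_eq_mul, mul_zero, not_false_eq_true]
  unfold mellin
  simp_rw [h]
  rw [setIntegral_indicator measurableSet_Ioi]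
  congr 2
  ext t
  simp only [Set.mem_inter_iff, Set.mem_Ioi]
  constructor
  · exact fun h => h.2
  · exact fun h => ⟨by linarith, h⟩

lemma gse_int (s : ℂ) :
    IntegrableOn (fun t : ℝ => (t : ℂ) ^ (s - 1) * (Real.exp (-t) : ℂ)) (Set.Ioi 1) := by
  have h : MellinConvergent _ s :=
    mellinConvergent_of_isBigO_rpow_exp one_pos gse_loc gse_top (gse_bot s) (by linarith : _ < s.re)
  unfold MellinConvergent at h
  have h2 := h.mono_set (Set.Ioi_subset_Ioi zero_le_one : Set.Ioi (1:ℝ) ⊆ _)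
  refine h2.congr_fun (fun t ht => ?_) measurableSet_Ioi
  simp only [ht, Set.indicator_of_mem, smul_eq_mul]

lemma gse_parts (z : ℂ) (hz : z ≠ 0) :
    (∫ t in Set.Ioi (1 : ℝ), (t : ℂ) ^ (z + 1 - 1) * Real.exp (-t))
      = Complex.exp (-1) + z * ∫ t in Set.Ioi (1 : ℝ), (t : ℂ) ^ (z - 1) * Real.exp (-t) := by
  have hd : ∀ t ∈ Set.Ici (1:ℝ), HasDerivAt (fun t : ℝ => -((t : ℂ) ^ z * (Real.exp (-t) : ℂ)))
      ((t : ℂ) ^ (z + 1 - 1) * (Real.exp (-t) : ℂ)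
        - z * ((t : ℂ) ^ (z - 1) * (Real.exp (-t) : ℂ))) t := by
    intro t ht
    have h0 : t ≠ 0 := by have : (1:ℝ) ≤ t := ht; linarith
    have h1 := hasDerivAt_ofReal_cpow_const h0 hz
    have h2 : HasDerivAt (fun t : ℝ => ((Real.exp (-t) : ℝ) : ℂ))
      ((Real.exp (-t) * (-1) : ℝ) : ℂ) t := ((hasDerivAt_neg t).exp).ofReal_comp
    refine (h1.mul h2).neg.congr_deriv ?_
    push_cast
    rw [add_sub_cancel_right]
    ring
  have hi := (gse_int (z+1)).sub ((gse_int z).const_mul z)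
  have ht : Filter.Tendsto (fun t : ℝ => -((t : ℂ) ^ z * (Real.exp (-t) : ℂ)))
      Filter.atTop (nhds 0) := by
    rw [tendsto_zero_iff_norm_tendsto_zero]
    refine (tendsto_rpow_mul_exp_neg_mul_atTop_nhds_zero z.re 1 one_pos).congr' ?_
    filter_upwards [Filter.eventually_gt_atTop 0] with t ht
    rw [norm_neg, norm_mul, norm_cpow_eq_rpow_re_of_pos ht, Complex.norm_real,
      Real.norm_of_nonneg (Real.exp_pos _).le]
    simp
  have := integral_Ioi_of_hasDerivAt_of_tendsto' hd hi ht
  rw [integral_sub (gse_int (z+1)) ((gse_int z).const_mul z), integral_const_mul] at this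
  rw [sub_eq_iff_eq_add] at this
  rw [this]
  simp

lemma gse_base (z : ℂ) (hz : 0 < z.re) :
    HasSum (fun k : ℕ => (-1) ^ k / ((k.factorial : ℂ) * (z + k)))
      (Complex.Gamma z - ∫ t in Set.Ioi (1 : ℝ), (t : ℂ) ^ (z - 1) * Real.exp (-t)) := by
  have hG : Complex.Gamma z - (∫ t in Set.Ioi (1 : ℝ), (t : ℂ) ^ (z - 1) * Real.exp (-t))
      = ∫ t in (0:ℝ)..1, (t : ℂ) ^ (z - 1) * (Real.exp (-t) : ℂ) := by
    have hi : IntegrableOn (fun t : ℝ => (t : ℂ) ^ (z - 1) * (Real.exp (-t) : ℂ)) (Set.Ioi 0) := by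
      refine (Complex.GammaIntegral_convergent hz).congr_fun (fun t _ => ?_) measurableSet_Ioi
      exact mul_comm _ _
    have : Complex.Gamma z = ∫ t in Set.Ioi (0 : ℝ), (t : ℂ) ^ (z - 1) * Real.exp (-t) := by
      rw [Complex.Gamma_eq_integral hz, Complex.GammaIntegral]
      simp_rw [mul_comm]
    rw [this, intervalIntegral.integral_of_le zero_le_one, sub_eq_iff_eq_add,
      ← Set.Ioc_union_Ioi_eq_Ioi (zero_le_one' ℝ),
      setIntegral_union (Set.Ioc_disjoint_Ioi le_rfl) measurableSet_Ioi
        (hi.mono_set Set.Ioc_subset_Ioi_self) (gse_int z)]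
  rw [hG]
  have hre : ∀ k : ℕ, -1 < (z + k - 1).re := by
    intro k
    have : (0:ℝ) ≤ k := k.cast_nonneg
    simp only [sub_re, add_re, natCast_re, one_re]
    linarith
  have key := intervalIntegral.hasSum_integral_of_dominated_convergence (μ := volume)
    (a := 0) (b := 1)
    (F := fun (k : ℕ) (t : ℝ) => ((-1) ^ k / (k.factorial : ℂ)) * (t : ℂ) ^ (z + k - 1))
    (f := fun t : ℝ => (t : ℂ) ^ (z - 1) * (Real.exp (-t) : ℂ))
    (fun k t => t ^ (z.re - 1) * (1 ^ k / (k.factorial : ℝ))) ?_ ?_ ?_ ?_ ?_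
  · convert! key using 2 with k
    rw [intervalIntegral.integral_const_mul, integral_cpow (Or.inl (hre k))]
    have h0 : z + k ≠ 0 := by
      intro h
      have := hre k
      rw [h] at this
      simp at this
    have hf : (k.factorial : ℂ) ≠ 0 := by exact_mod_cast k.factorial_ne_zero
    rw [sub_add_cancel]
    simp only [ofReal_one, one_cpow, ofReal_zero, zero_cpow h0, sub_zero]
    field_simp
  · intro k
    have := (intervalIntegral.intervalIntegrable_cpow' (a := 0) (b := 1) (hre k)).const_mul
      ((-1) ^ k / (k.factorial : ℂ))
    exact this.def'.aestronglyMeasurable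
  · intro k
    filter_upwards with t ht
    rw [Set.uIoc_of_le zero_le_one] at ht
    rw [norm_mul, norm_cpow_eq_rpow_re_of_pos ht.1, norm_div, norm_pow, norm_neg, norm_one,
      Complex.norm_natCast, mul_comm]
    gcongr ?_ * _
    apply Real.rpow_le_rpow_of_exponent_ge ht.1 ht.2
    simp
  · filter_upwards with t ht
    exact (Real.summable_pow_div_factorial 1).mul_left _
  · simp_rw [tsum_mul_left]
    exact (intervalIntegral.intervalIntegrable_rpow' (by linarith)).mul_const _
  · filter_upwards with t ht
    rw [Set.uIoc_of_le zero_le_one] at ht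
    have h := (NormedSpace.expSeries_div_hasSum_exp (-(t:ℂ))).mul_left ((t:ℂ) ^ (z - 1))
    rw [← Complex.exp_eq_exp_ℂ] at h
    convert! h using 2 with k
    · have ht0 : (t : ℂ) ≠ 0 := by exact_mod_cast ht.1.ne'
      rw [show z + k - 1 = (z - 1) + k by ring, cpow_add _ _ ht0, cpow_natCast, neg_pow (t:ℂ)]
      ring
    · push_cast
      rfl

lemma gse_main (n : ℕ) : ∀ z : ℂ, -(n : ℝ) < z.re → (∀ n : ℕ, z ≠ -(n : ℂ)) →
    HasSum (fun k : ℕ => (-1) ^ k / ((k.factorial : ℂ) * (z + k)))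
      (Complex.Gamma z - ∫ t in Set.Ioi (1 : ℝ), (t : ℂ) ^ (z - 1) * Real.exp (-t)) := by
  induction n with
  | zero => intro z hz _; exact gse_base z (by simpa using hz)
  | succ n ih =>
    intro z hz hn
    have hz0 : z ≠ 0 := by simpa using hn 0
    have h1 := ih (z + 1) (by push_cast at hz; simp only [add_re, one_re]; linarith) (by
      intro m hm
      apply hn (m + 1)
      push_cast
      linear_combination hm)
    have he := NormedSpace.expSeries_div_hasSum_exp (-1 : ℂ)
    rw [← Complex.exp_eq_exp_ℂ] at he
    have he' := (hasSum_nat_add_iff' 1).mpr he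
    have h2 := he'.add h1
    rw [gse_parts z hz0, Complex.Gamma_add_one z hz0] at h2
    rw [← hasSum_mul_left_iff hz0]
    rw [← hasSum_nat_add_iff' 1]
    convert! h2 using 1
    · funext k
      have hk : z + (k + 1) ≠ 0 := by
        intro h
        apply hn (k + 1)
        push_cast
        linear_combination h
      have hk' : z + 1 + k ≠ 0 := by
        intro h
        apply hk
        linear_combination h
      have hf : (k.factorial : ℂ) ≠ 0 := by exact_mod_cast k.factorial_ne_zero
      have hk1 : (k + 1 : ℂ) ≠ 0 := by exact_mod_cast k.succ_ne_zero
      rw [Nat.factorial_succ]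
      push_cast
      field_simp
      ring
    · simp only [Finset.sum_range_one, pow_zero, Nat.factorial_zero, Nat.cast_one, Nat.cast_zero,
        add_zero, one_mul, div_one, mul_one_div_cancel hz0]
      ring

/-- Singular expansion of the Gamma function: `Γ(z) = Σ_k (-1)^k/(k! (z+k)) + E(z)`
with `E` entire. -/
theorem gamma_singular_expansion :
    Differentiable ℂ
        (fun z : ℂ => ∫ t in Set.Ioi (1 : ℝ), (t : ℂ) ^ (z - 1) * Real.exp (-t)) ∧
      ∀ z : ℂ, (∀ n : ℕ, z ≠ -(n : ℂ)) →
        Summable (fun k : ℕ => (-1) ^ k / ((k.factorial : ℂ) * (z + k))) ∧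
          Complex.Gamma z
            = (∑' k : ℕ, (-1) ^ k / ((k.factorial : ℂ) * (z + k)))
              + ∫ t in Set.Ioi (1 : ℝ), (t : ℂ) ^ (z - 1) * Real.exp (-t) := by
  constructor
  · simp_rw [← gse_eq]
    intro s
    exact mellin_differentiableAt_of_isBigO_rpow_exp one_pos gse_loc gse_top (gse_bot s)
      (by linarith : _ < s.re)
  · intro z hz
    obtain ⟨n, hn⟩ := exists_nat_gt (-z.re)
    have h := gse_main n z (by linarith) hz
    exact ⟨h.summable, by rw [h.tsum_eq]; ring⟩
end

section
/- Reference-point independence of the leading conformal soft factor: Let V be a vector space over ℂ, let z_s, z₁, …, z_n ∈ ℂ with z_i ≠ z_s for all i, and let w₁, …, w_n ∈ V satisfy Σ_{i=1}^n w_i = 0 and Σ_{i=1}^n z_i • w_i = 0. Then for all σ, τ ∈ ℂ with σ ≠ z_s and τ ≠ z_s, Σ_{i=1}^n ( (σ − z_i)² / ( (σ − z_s)² (z_s − z_i) ) ) • w_i = Σ_{i=1}^n ( (τ − z_i)² / ( (τ − z_s)² (z_s − z_i) ) ) • w_i. -/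
/-- Reference-point independence of the leading (Weinberg) conformal soft factor. -/
theorem leading_soft_factor_reference_independent
    (V : Type*) [AddCommGroup V] [Module ℂ V]
    (n : ℕ) (zs : ℂ) (z : Fin n → ℂ) (hz : ∀ i, z i ≠ zs)
    (w : Fin n → V) (hw0 : ∑ i, w i = 0) (hw1 : ∑ i, z i • w i = 0)
    (σ τ : ℂ) (hσ : σ ≠ zs) (hτ : τ ≠ zs) :
    ∑ i, ((σ - z i) ^ 2 / ((σ - zs) ^ 2 * (zs - z i))) • w i
      = ∑ i, ((τ - z i) ^ 2 / ((τ - zs) ^ 2 * (zs - z i))) • w i := by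
  have key : ∀ ρ : ℂ, ρ ≠ zs →
      ∑ i, ((ρ - z i) ^ 2 / ((ρ - zs) ^ 2 * (zs - z i))) • w i
        = ∑ i, (1 / (zs - z i)) • w i := by
    intro ρ hρ
    have h : ∀ i, ((ρ - z i) ^ 2 / ((ρ - zs) ^ 2 * (zs - z i))) • w i
        = (1 / (zs - z i)) • w i + ((2 * ρ - zs) / (ρ - zs) ^ 2) • w i
          + (-1 / (ρ - zs) ^ 2) • (z i • w i) := by
      intro i
      have h1 : ρ - zs ≠ 0 := sub_ne_zero.mpr hρ
      have h2 : zs - z i ≠ 0 := sub_ne_zero.mpr (hz i).symm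
      rw [smul_smul, ← add_smul, ← add_smul]
      congr 1
      field_simp
      ring
    simp only [h, Finset.sum_add_distrib, ← Finset.smul_sum, hw0, hw1, smul_zero, add_zero]
  rw [key σ hσ, key τ hτ]
end
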